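/- arXiv:2102.06035 — 8 statements merged into one kernel-verified Lean document; each statement's English description precedes it below -/
import Mathlib

section
/- Let f : ℝ^d → ℝ be a differentiable convex L-smooth function (L > 0) attaining its minimum at x*. Let (x_k) be defined by gradient descent with stepsize 1/L: x_{k+1} = x_k − (1/L)∇f(x_k). Then for every k ≥ 1, f(x_k) − f(x*) ≤ 2L‖x_0 − x*‖² / (k + 4). -/
open scoped RealInnerProductSpace

section GradientStep

variable {E : Type*} [NormedAddCommGroup E] [InnerProductSpace ℝ E] [CompleteSpace E]
  {f : E → ℝ} {L : ℝ}

/-- A gradient step of length `1/L` decreases an `L`-smooth function by `‖∇f x‖² / (2L)`. -/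
lemma apply_gradient_step_le (hL : 0 < L)
    (hsmooth : ∀ x y, f y ≤ f x + ⟪gradient f x, y - x⟫ + L / 2 * ‖y - x‖ ^ 2) (x : E) :
    f (x - (1 / L) • gradient f x) ≤ f x - ‖gradient f x‖ ^ 2 / (2 * L) := by
  have h := hsmooth x (x - (1 / L) • gradient f x)
  rw [sub_sub_cancel_left, inner_neg_right, inner_smul_right, real_inner_self_eq_norm_sq,
    norm_neg, norm_smul, Real.norm_of_nonneg (by positivity)] at h
  convert h using 1
  field_simp
  ring

lemma gradient_eq_zero_of_forall_le (hL : 0 < L)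
    (hsmooth : ∀ x y, f y ≤ f x + ⟪gradient f x, y - x⟫ + L / 2 * ‖y - x‖ ^ 2)
    {xstar : E} (hmin : ∀ y, f xstar ≤ f y) : gradient f xstar = 0 := by
  have h : ‖gradient f xstar‖ ^ 2 / (2 * L) ≤ 0 := by
    linarith [apply_gradient_step_le hL hsmooth xstar, hmin (xstar - (1 / L) • gradient f xstar)]
  rw [div_le_iff₀ (by positivity), zero_mul] at h
  simpa using le_antisymm h (sq_nonneg _)

/-- Convexity at a minimizer, strengthened by smoothness. -/
lemma sub_min_le_inner_sub (hL : 0 < L)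
    (hsmooth : ∀ x y, f y ≤ f x + ⟪gradient f x, y - x⟫ + L / 2 * ‖y - x‖ ^ 2)
    (hconv : ∀ x y, f x + ⟪gradient f x, y - x⟫ ≤ f y)
    {xstar : E} (hmin : ∀ y, f xstar ≤ f y) (x : E) :
    f x - f xstar ≤ ⟪gradient f x, x - xstar⟫ - ‖gradient f x‖ ^ 2 / (2 * L) := by
  have hs := hsmooth xstar (xstar + (1 / L) • gradient f x)
  have hc := hconv x (xstar + (1 / L) • gradient f x)
  rw [gradient_eq_zero_of_forall_le hL hsmooth hmin, inner_zero_left, add_sub_cancel_left,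
    norm_smul, Real.norm_of_nonneg (by positivity)] at hs
  rw [show xstar + (1 / L) • gradient f x - x = (1 / L) • gradient f x - (x - xstar) by abel,
    inner_sub_right, inner_smul_right, real_inner_self_eq_norm_sq] at hc
  have h : 1 / L * ‖gradient f x‖ ^ 2 - L / 2 * (1 / L * ‖gradient f x‖) ^ 2
      = ‖gradient f x‖ ^ 2 / (2 * L) := by
    field_simp
    ring
  linarith

lemma apply_gradient_step_sub_min_le (hL : 0 < L)
    (hsmooth : ∀ x y, f y ≤ f x + ⟪gradient f x, y - x⟫ + L / 2 * ‖y - x‖ ^ 2)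
    (hconv : ∀ x y, f x + ⟪gradient f x, y - x⟫ ≤ f y)
    {xstar : E} (hmin : ∀ y, f xstar ≤ f y) (x : E) :
    f (x - (1 / L) • gradient f x) - f xstar ≤
      ⟪gradient f x, x - xstar⟫ - ‖gradient f x‖ ^ 2 / L := by
  have h : ‖gradient f x‖ ^ 2 / (2 * L) + ‖gradient f x‖ ^ 2 / (2 * L)
      = ‖gradient f x‖ ^ 2 / L := by
    field_simp
    ring
  linarith [apply_gradient_step_le hL hsmooth x, sub_min_le_inner_sub hL hsmooth hconv hmin x]

lemma apply_gradient_step_sub_min_le_quarter (hL : 0 < L)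
    (hsmooth : ∀ x y, f y ≤ f x + ⟪gradient f x, y - x⟫ + L / 2 * ‖y - x‖ ^ 2)
    (hconv : ∀ x y, f x + ⟪gradient f x, y - x⟫ ≤ f y)
    {xstar : E} (hmin : ∀ y, f xstar ≤ f y) (x : E) :
    f (x - (1 / L) • gradient f x) - f xstar ≤ L / 4 * ‖x - xstar‖ ^ 2 := by
  have h := apply_gradient_step_sub_min_le hL hsmooth hconv hmin x
  have hcs := real_inner_le_norm (gradient f x) (x - xstar)
  have hsq : 0 ≤ L * (‖gradient f x‖ / L - ‖x - xstar‖ / 2) ^ 2 := by positivity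
  have heq : L * (‖gradient f x‖ / L - ‖x - xstar‖ / 2) ^ 2
      = ‖gradient f x‖ ^ 2 / L - ‖gradient f x‖ * ‖x - xstar‖ + L / 4 * ‖x - xstar‖ ^ 2 := by
    field_simp
    ring
  linarith

lemma apply_gradient_step_add_dist_sq_le (hL : 0 < L)
    (hsmooth : ∀ x y, f y ≤ f x + ⟪gradient f x, y - x⟫ + L / 2 * ‖y - x‖ ^ 2)
    (hconv : ∀ x y, f x + ⟪gradient f x, y - x⟫ ≤ f y)
    {xstar : E} (hmin : ∀ y, f xstar ≤ f y) (x : E) :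
    f (x - (1 / L) • gradient f x) - f xstar
        + L / 2 * ‖x - (1 / L) • gradient f x - xstar‖ ^ 2 ≤ L / 2 * ‖x - xstar‖ ^ 2 := by
  have h := apply_gradient_step_sub_min_le hL hsmooth hconv hmin x
  rw [show x - (1 / L) • gradient f x - xstar = x - xstar - (1 / L) • gradient f x by abel,
    norm_sub_sq_real, inner_smul_right, real_inner_comm, norm_smul,
    Real.norm_of_nonneg (by positivity)]
  have hexp : L / 2 * (‖x - xstar‖ ^ 2 - 2 * (1 / L * ⟪gradient f x, x - xstar⟫)
        + (1 / L * ‖gradient f x‖) ^ 2)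
      = L / 2 * ‖x - xstar‖ ^ 2 - ⟪gradient f x, x - xstar⟫
        + ‖gradient f x‖ ^ 2 / L / 2 := by
    field_simp
  have hnonneg : 0 ≤ ‖gradient f x‖ ^ 2 / L := by positivity
  linarith

/-- The potential `k (f xₖ - f x*) + (L/2) ‖xₖ - x*‖²` of gradient descent never exceeds its
initial value. -/
lemma gradient_descent_potential_le (hL : 0 < L)
    (hsmooth : ∀ x y, f y ≤ f x + ⟪gradient f x, y - x⟫ + L / 2 * ‖y - x‖ ^ 2)
    (hconv : ∀ x y, f x + ⟪gradient f x, y - x⟫ ≤ f y)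
    {xstar : E} (hmin : ∀ y, f xstar ≤ f y) {x : ℕ → E}
    (hrec : ∀ k, x (k + 1) = x k - (1 / L) • gradient f (x k)) (k : ℕ) :
    k * (f (x k) - f xstar) + L / 2 * ‖x k - xstar‖ ^ 2 ≤ L / 2 * ‖x 0 - xstar‖ ^ 2 := by
  induction k with
  | zero => simp
  | succ k ih =>
    have hstep := apply_gradient_step_add_dist_sq_le hL hsmooth hconv hmin (x k)
    have hdesc : f (x (k + 1)) ≤ f (x k) := by
      have hnonneg : 0 ≤ ‖gradient f (x k)‖ ^ 2 / (2 * L) := by positivity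
      rw [hrec]
      linarith [apply_gradient_step_le hL hsmooth (x k)]
    rw [← hrec] at hstep
    have hmul := mul_le_mul_of_nonneg_left hdesc (Nat.cast_nonneg (α := ℝ) k)
    push_cast
    linarith

end GradientStep

/-- Gradient descent with stepsize `1/L` on a differentiable convex
`L`-smooth function satisfies `f xₖ - f x* ≤ 2L‖x₀ - x*‖² / (k + 4)` for `k ≥ 1`. -/
theorem gradient_descent_convex_rate {d : ℕ} (f : EuclideanSpace ℝ (Fin d) → ℝ)
    (L : ℝ) (hL : 0 < L)
    (hdiff : Differentiable ℝ f)
    (hsmooth : ∀ x y, f y ≤ f x + ⟪gradient f x, y - x⟫ + L / 2 * ‖y - x‖ ^ 2)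
    (hconv : ∀ x y, f x + ⟪gradient f x, y - x⟫ ≤ f y)
    (xstar : EuclideanSpace ℝ (Fin d)) (hmin : ∀ y, f xstar ≤ f y)
    (x : ℕ → EuclideanSpace ℝ (Fin d))
    (hrec : ∀ k, x (k + 1) = x k - (1 / L) • gradient f (x k))
    (k : ℕ) (hk : 1 ≤ k) :
    f (x k) - f xstar ≤ 2 * L * ‖x 0 - xstar‖ ^ 2 / ((k : ℝ) + 4) := by
  rw [le_div_iff₀ (by positivity)]
  obtain rfl | hk2 := hk.eq_or_lt
  · have h := apply_gradient_step_sub_min_le_quarter hL hsmooth hconv hmin (x 0)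
    rw [← hrec, zero_add] at h
    have hnonneg : 0 ≤ L * ‖x 0 - xstar‖ ^ 2 := by positivity
    norm_num
    linarith
  · have h := gradient_descent_potential_le hL hsmooth hconv hmin hrec k
    have hnonneg : 0 ≤ L / 2 * ‖x k - xstar‖ ^ 2 := by positivity
    have hk2' : (2 : ℝ) ≤ k := by exact_mod_cast hk2
    have hle : (f (x k) - f xstar) * (k + 4) ≤ (f (x k) - f xstar) * (4 * k) :=
      mul_le_mul_of_nonneg_left (by linarith) (sub_nonneg.2 (hmin _))
    linarith
end

section
/- Let f : ℝ^d → ℝ be a differentiable convex L-smooth function (L > 0) attaining its minimum at x*. Define A_0 = 0 and A_{k+1} = A_k + (1/2)(1 + √(4A_k + 1)). Let sequences (x_k), (y_k), (z_k) in ℝ^d with z_0 = x_0 satisfy, for all k ≥ 0: y_k = x_k + (1 − A_k/A_{k+1})(z_k − x_k), x_{k+1} = y_k − (1/L)∇f(y_k), and z_{k+1} = z_k − ((A_{k+1} − A_k)/L)∇f(y_k). Then for every k ≥ 1, f(x_k) − f(x*) ≤ 2L‖x_0 − x*‖² / k². -/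
open scoped RealInnerProductSpace

/-- One step of the recursion for the weights: the squared increment is the new weight. -/
lemma nesterov_weight_sub_sq {a b : ℝ} (ha : 0 ≤ a)
    (hb : b = a + 1 / 2 * (1 + Real.sqrt (4 * a + 1))) : (b - a) ^ 2 = b := by
  have h := Real.sq_sqrt (show (0 : ℝ) ≤ 4 * a + 1 by linarith)
  subst hb
  linear_combination h / 4

/-- The weights of Nesterov's method grow at least quadratically. -/
lemma nesterov_weight_lower_bound {A : ℕ → ℝ} (hA0 : A 0 = 0)
    (hArec : ∀ k, A (k + 1) = A k + 1 / 2 * (1 + Real.sqrt (4 * A k + 1))) (k : ℕ) :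
    (k : ℝ) ^ 2 / 4 ≤ A k := by
  induction k with
  | zero => simp [hA0]
  | succ n ih =>
    have hs : Real.sqrt ((n : ℝ) ^ 2 + 1) ≤ Real.sqrt (4 * A n + 1) :=
      Real.sqrt_le_sqrt (by linarith)
    have hn : (n : ℝ) + 1 / 2 ≤ 1 / 2 + Real.sqrt ((n : ℝ) ^ 2 + 1) := by
      have : (n : ℝ) ≤ Real.sqrt ((n : ℝ) ^ 2 + 1) := Real.le_sqrt_of_sq_le (by linarith)
      linarith
    rw [hArec n]
    push_cast
    nlinarith

/-- The Lyapunov function of Nesterov's method does not increase along one step, where `g` is the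
gradient at the extrapolated point `y`, and `fx`, `fx'`, `fy`, `fs` are the values of the objective
at `x`, at the gradient step from `y`, at `y` and at the reference point `s`. -/
lemma nesterov_lyapunov_step {E : Type*} [NormedAddCommGroup E] [InnerProductSpace ℝ E]
    {L a b fx fx' fy fs : ℝ} (hL : 0 < L) (ha : 0 ≤ a) (hab : a ≤ b) (hb : 0 < b)
    (hsq : (b - a) ^ 2 = b) {x y z z' s g : E}
    (hy : y = x + (1 - a / b) • (z - x)) (hz : z' = z - ((b - a) / L) • g)
    (hdescent : fx' ≤ fy - 1 / (2 * L) * ‖g‖ ^ 2)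
    (hfx : fy + ⟪g, x - y⟫ ≤ fx) (hfs : fy + ⟪g, s - y⟫ ≤ fs) :
    b * (fx' - fs) + L / 2 * ‖z' - s‖ ^ 2 ≤ a * (fx - fs) + L / 2 * ‖z - s‖ ^ 2 := by
  have hcomb : a • (x - y) + (b - a) • (s - y) = (b - a) • (s - z) := by
    have hby : b • y = a • x + (b - a) • z := by
      have hba : b * (1 - a / b) = b - a := by field_simp
      rw [hy, smul_add, smul_smul, hba]
      module
    linear_combination (norm := module) -hby
  have hinner : a * ⟪g, x - y⟫ + (b - a) * ⟪g, s - y⟫ = -((b - a) * ⟪g, z - s⟫) := by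
    have h := congrArg (fun v => ⟪g, v⟫) hcomb
    simp only [inner_add_right, inner_smul_right] at h
    rw [h, ← neg_sub z s, inner_neg_right]
    ring
  have hnorm : L / 2 * ‖z' - s‖ ^ 2
      = L / 2 * ‖z - s‖ ^ 2 - (b - a) * ⟪g, z - s⟫ + b * (1 / (2 * L) * ‖g‖ ^ 2) := by
    have hzs : z' - s = (z - s) - ((b - a) / L) • g := by rw [hz]; abel
    rw [hzs, norm_sub_sq_real, inner_smul_right, norm_smul, mul_pow, Real.norm_eq_abs, sq_abs,
      div_pow, hsq, real_inner_comm]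
    field_simp
  have h1 := mul_le_mul_of_nonneg_left hdescent hb.le
  have h2 := mul_le_mul_of_nonneg_left hfx ha
  have h3 := mul_le_mul_of_nonneg_left hfs (sub_nonneg.2 hab)
  linarith

/-- Nesterov's accelerated gradient method (three-sequence form) for a
differentiable convex `L`-smooth function, with the parameter sequence
`A₀ = 0`, `A_{k+1} = A_k + (1/2)(1 + √(4A_k + 1))`, satisfies
`f xₖ - f x* ≤ 2L‖x₀ - x*‖² / k²` for `k ≥ 1`. -/
theorem nesterov_convex_rate {d : ℕ} (f : EuclideanSpace ℝ (Fin d) → ℝ)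
    (L : ℝ) (hL : 0 < L)
    (hdiff : Differentiable ℝ f)
    (hsmooth : ∀ x y, f y ≤ f x + ⟪gradient f x, y - x⟫ + L / 2 * ‖y - x‖ ^ 2)
    (hconv : ∀ x y, f x + ⟪gradient f x, y - x⟫ ≤ f y)
    (xstar : EuclideanSpace ℝ (Fin d)) (hmin : ∀ y, f xstar ≤ f y)
    (A : ℕ → ℝ) (hA0 : A 0 = 0)
    (hArec : ∀ k, A (k + 1) = A k + 1 / 2 * (1 + Real.sqrt (4 * A k + 1)))
    (x y z : ℕ → EuclideanSpace ℝ (Fin d)) (hz0 : z 0 = x 0)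
    (hy : ∀ k, y k = x k + (1 - A k / A (k + 1)) • (z k - x k))
    (hx : ∀ k, x (k + 1) = y k - (1 / L) • gradient f (y k))
    (hz : ∀ k, z (k + 1) = z k - ((A (k + 1) - A k) / L) • gradient f (y k))
    (k : ℕ) (hk : 1 ≤ k) :
    f (x k) - f xstar ≤ 2 * L * ‖x 0 - xstar‖ ^ 2 / (k : ℝ) ^ 2 := by
  have hAlow := nesterov_weight_lower_bound hA0 hArec
  have hAnn (n : ℕ) : 0 ≤ A n := le_trans (by positivity) (hAlow n)
  have hdescent (n : ℕ) :
      f (x (n + 1)) ≤ f (y n) - 1 / (2 * L) * ‖gradient f (y n)‖ ^ 2 := by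
    have h := hsmooth (y n) (x (n + 1))
    have hxy : x (n + 1) - y n = -((1 / L) • gradient f (y n)) := by rw [hx n]; abel
    rw [hxy, inner_neg_right, inner_smul_right, real_inner_self_eq_norm_sq, norm_neg, norm_smul,
      mul_pow, Real.norm_eq_abs, sq_abs] at h
    refine h.trans_eq ?_
    field_simp
    ring
  have hlyap (n : ℕ) :
      A n * (f (x n) - f xstar) + L / 2 * ‖z n - xstar‖ ^ 2 ≤ L / 2 * ‖x 0 - xstar‖ ^ 2 := by
    induction n with
    | zero => simp [hA0, hz0]
    | succ n ih =>
      have hlt : A n < A (n + 1) := by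
        rw [hArec n]
        linarith [Real.sqrt_nonneg (4 * A n + 1)]
      exact (nesterov_lyapunov_step hL (hAnn n) hlt.le ((hAnn n).trans_lt hlt)
        (nesterov_weight_sub_sq (hAnn n) (hArec n)) (hy n) (hz n) (hdescent n)
        (hconv (y n) (x n)) (hconv (y n) xstar)).trans ih
  have hkpos : (0 : ℝ) < k := by exact_mod_cast hk
  have hgap := mul_le_mul_of_nonneg_right (hAlow k) (sub_nonneg.2 (hmin (x k)))
  have hznn : 0 ≤ L / 2 * ‖z k - xstar‖ ^ 2 := by positivity
  rw [le_div_iff₀ (by positivity)]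
  linarith [hlyap k]
end

section
/- Let f : ℝ^d → ℝ be a differentiable L-smooth and μ-strongly convex function (0 < μ ≤ L) attaining its minimum at x*. Let sequences (x_k), (y_k), (z_k) in ℝ^d satisfy, for all k ≥ 0: y_k = x_k + (√(μ/L)/(1 + √(μ/L)))(z_k − x_k), x_{k+1} = y_k − (1/L)∇f(y_k), and z_{k+1} = z_k + √(μ/L)(y_k − z_k) − (1/√(μL))∇f(y_k). Then for every k ≥ 0, f(x_k) − f(x*) ≤ (f(x_0) − f(x*) + (μ/2)‖z_0 − x*‖²)(1 − √(μ/L))^k. -/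
open scoped RealInnerProductSpace

/-- One step of Nesterov's method, with `q = √(μ/L)`, contracts the Lyapunov function
`f x - f x* + (μ/2)‖z - x*‖²` by the factor `1 - q`. -/
theorem nesterov_lyapunov_step_s3 {E : Type*} [NormedAddCommGroup E] [InnerProductSpace ℝ E]
    [CompleteSpace E] (f : E → ℝ) {L μ q : ℝ} (hL : 0 < L) (hq : 0 < q) (hq1 : q ≤ 1)
    (hμ : μ = q ^ 2 * L)
    (hsmooth : ∀ x y, f y ≤ f x + ⟪gradient f x, y - x⟫ + L / 2 * ‖y - x‖ ^ 2)
    (hstrconv : ∀ x y, f x + ⟪gradient f x, y - x⟫ + μ / 2 * ‖y - x‖ ^ 2 ≤ f y)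
    (p x y z : E) (hy : y = x + (q / (1 + q)) • (z - x)) :
    f (y - (1 / L) • gradient f y) - f p
        + μ / 2 * ‖z + q • (y - z) - (1 / (q * L)) • gradient f y - p‖ ^ 2
      ≤ (1 - q) * (f x - f p + μ / 2 * ‖z - p‖ ^ 2) := by
  have hx : x - y = -(q • (z - y)) := by
    subst hy
    match_scalars <;> field_simp <;> ring
  have hsm := hsmooth y (y - (1 / L) • gradient f y)
  have hcx := hstrconv y x
  have hcp := hstrconv y p
  generalize gradient f y = g at *
  have hdescent : f (y - (1 / L) • g) ≤ f y - 1 / (2 * L) * ‖g‖ ^ 2 := by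
    have h : y - (1 / L) • g - y = -((1 / L) • g) := by abel
    rw [h, inner_neg_right, real_inner_smul_right, real_inner_self_eq_norm_sq, norm_neg,
      norm_smul, mul_pow, Real.norm_eq_abs, sq_abs] at hsm
    convert hsm using 1
    field_simp
    ring
  obtain ⟨u, hu⟩ : ∃ u, u = z - y := ⟨_, rfl⟩
  obtain ⟨w, hw⟩ : ∃ w, w = y - p := ⟨_, rfl⟩
  have hpy : p - y = -w := by rw [hw]; abel
  have hzp : z - p = u + w := by rw [hu, hw]; abel
  have hznext : z + q • (y - z) - (1 / (q * L)) • g - p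
      = w + (1 - q) • u - (1 / (q * L)) • g := by
    rw [hu, hw]; module
  have hnorm : μ / 2 * ‖w + (1 - q) • u - (1 / (q * L)) • g‖ ^ 2
      = μ / 2 * (‖w‖ ^ 2 + 2 * (1 - q) * ⟪u, w⟫ + (1 - q) ^ 2 * ‖u‖ ^ 2)
        - q * (⟪g, w⟫ + (1 - q) * ⟪g, u⟫) + 1 / (2 * L) * ‖g‖ ^ 2 := by
    rw [norm_sub_sq_real, norm_add_sq_real, norm_smul, norm_smul, mul_pow, mul_pow,
      Real.norm_eq_abs, Real.norm_eq_abs, sq_abs, sq_abs, inner_add_left,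
      real_inner_smul_right, real_inner_smul_right, real_inner_smul_right,
      real_inner_smul_left, real_inner_comm g w, real_inner_comm g u, real_inner_comm u w, hμ]
    field_simp
  rw [hx, ← hu, inner_neg_right, real_inner_smul_right, norm_neg] at hcx
  rw [hpy, inner_neg_right, norm_neg] at hcp
  rw [hznext, hnorm, hzp, norm_add_sq_real]
  have hμ0 : 0 ≤ μ := by rw [hμ]; positivity
  have hcx' : f y - q * ⟪g, u⟫ ≤ f x := by
    have : 0 ≤ μ / 2 * ‖q • u‖ ^ 2 := by positivity
    linarith
  have h1 := mul_le_mul_of_nonneg_left hcx' (sub_nonneg.2 hq1)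
  have h2 := mul_le_mul_of_nonneg_left hcp hq.le
  have h3 : 0 ≤ μ / 2 * (q * (1 - q) * ‖u‖ ^ 2) := by
    have := sub_nonneg.2 hq1
    positivity
  linarith

/-- Nesterov's accelerated gradient method for a differentiable `L`-smooth
`μ`-strongly convex function (constant parameters `τ = √(μ/L)/(1+√(μ/L))`, `τ' = √(μ/L)`,
`γ = 1/L`, `γ' = 1/√(μL)`) satisfies
`f xₖ - f x* ≤ (f x₀ - f x* + (μ/2)‖z₀ - x*‖²)(1 - √(μ/L))^k`. -/
theorem nesterov_strongly_convex_rate {d : ℕ} (f : EuclideanSpace ℝ (Fin d) → ℝ)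
    (L μ : ℝ) (hμ : 0 < μ) (hμL : μ ≤ L)
    (hdiff : Differentiable ℝ f)
    (hsmooth : ∀ x y, f y ≤ f x + ⟪gradient f x, y - x⟫ + L / 2 * ‖y - x‖ ^ 2)
    (hstrconv : ∀ x y, f x + ⟪gradient f x, y - x⟫ + μ / 2 * ‖y - x‖ ^ 2 ≤ f y)
    (xstar : EuclideanSpace ℝ (Fin d)) (hmin : ∀ y, f xstar ≤ f y)
    (x y z : ℕ → EuclideanSpace ℝ (Fin d))
    (hy : ∀ k, y k = x k +
      (Real.sqrt (μ / L) / (1 + Real.sqrt (μ / L))) • (z k - x k))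
    (hx : ∀ k, x (k + 1) = y k - (1 / L) • gradient f (y k))
    (hz : ∀ k, z (k + 1) = z k + Real.sqrt (μ / L) • (y k - z k)
      - (1 / Real.sqrt (μ * L)) • gradient f (y k))
    (k : ℕ) :
    f (x k) - f xstar ≤
      (f (x 0) - f xstar + μ / 2 * ‖z 0 - xstar‖ ^ 2) * (1 - Real.sqrt (μ / L)) ^ k := by
  have hL : 0 < L := hμ.trans_le hμL
  have hq : 0 < √(μ / L) := Real.sqrt_pos.2 (div_pos hμ hL)
  have hq1 : √(μ / L) ≤ 1 := Real.sqrt_le_one.2 ((div_le_one hL).2 hμL)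
  have hμq : μ = √(μ / L) ^ 2 * L := by
    rw [Real.sq_sqrt (div_pos hμ hL).le, div_mul_cancel₀ _ hL.ne']
  have hqL : √(μ * L) = √(μ / L) * L := by
    rw [Real.sqrt_eq_iff_mul_self_eq (by positivity) (by positivity)]
    linear_combination L * hμq
  have hlyap : ∀ n, f (x n) - f xstar + μ / 2 * ‖z n - xstar‖ ^ 2 ≤
      (f (x 0) - f xstar + μ / 2 * ‖z 0 - xstar‖ ^ 2) * (1 - √(μ / L)) ^ n := by
    intro n
    induction n with
    | zero => simp
    | succ n ih =>
      have hstep := nesterov_lyapunov_step_s3 f hL hq hq1 hμq hsmooth hstrconv xstar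
        (x n) (y n) (z n) (hy n)
      rw [← hqL, ← hx, ← hz] at hstep
      calc _ ≤ _ := hstep
        _ ≤ _ := mul_le_mul_of_nonneg_left ih (sub_nonneg.2 hq1)
        _ = _ := by ring
  have : 0 ≤ μ / 2 * ‖z k - xstar‖ ^ 2 := by positivity
  linarith [hlyap k]
end

section
/- Let f : ℝ^d → ℝ be a differentiable convex L-smooth function (L > 0) attaining its minimum at x*. Then for every t > 0 and all x, z ∈ ℝ^d: (t/L)(f(x) − f(x*)) + (t/L)⟨∇f(x), z − x⟩ + (t²/(2L))(f(x − (1/L)∇f(x)) − f(x)) + ‖z − (t/(2L))∇f(x) − x*‖² − ‖z − x*‖² ≤ 0. -/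
open scoped RealInnerProductSpace

/-- Pointwise nonpositivity of the drift of the Lyapunov function
`φ_t = (t²/(2L))(f(x_t) - f(x*)) + ‖z_t - x*‖²` for the convex-case continuized
Nesterov parameters `η_t = 2/t`, `η'_t = 0`, `γ_t = 1/L`, `γ'_t = t/(2L)`. -/
theorem continuized_drift_nonpos_convex {d : ℕ} (f : EuclideanSpace ℝ (Fin d) → ℝ)
    (L : ℝ) (hL : 0 < L)
    (hdiff : Differentiable ℝ f)
    (hsmooth : ∀ x y, f y ≤ f x + ⟪gradient f x, y - x⟫ + L / 2 * ‖y - x‖ ^ 2)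
    (hconv : ∀ x y, f x + ⟪gradient f x, y - x⟫ ≤ f y)
    (xstar : EuclideanSpace ℝ (Fin d)) (hmin : ∀ y, f xstar ≤ f y)
    (t : ℝ) (ht : 0 < t) (x z : EuclideanSpace ℝ (Fin d)) :
    t / L * (f x - f xstar) + t / L * ⟪gradient f x, z - x⟫
      + t ^ 2 / (2 * L) * (f (x - (1 / L) • gradient f x) - f x)
      + ‖z - (t / (2 * L)) • gradient f x - xstar‖ ^ 2 - ‖z - xstar‖ ^ 2 ≤ 0 := by
  set g := gradient f x
  have descent : f (x - (1 / L) • g) - f x ≤ -(1 / (2 * L)) * ‖g‖ ^ 2 := by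
    have h := hsmooth x (x - (1 / L) • g)
    rw [sub_sub_cancel_left, norm_neg, inner_neg_right, real_inner_smul_right,
      real_inner_self_eq_norm_sq, norm_smul, Real.norm_of_nonneg (by positivity : 0 ≤ 1 / L)] at h
    have e : -(1 / L * ‖g‖ ^ 2) + L / 2 * (1 / L * ‖g‖) ^ 2 = -(1 / (2 * L)) * ‖g‖ ^ 2 := by
      field_simp
      ring
    linarith
  have expand : ‖z - (t / (2 * L)) • g - xstar‖ ^ 2 - ‖z - xstar‖ ^ 2
      = -(t / L) * ⟪g, z - xstar⟫ + t ^ 2 / (2 * L) * (1 / (2 * L) * ‖g‖ ^ 2) := by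
    rw [sub_right_comm, norm_sub_sq_real, real_inner_smul_right, norm_smul,
      Real.norm_of_nonneg (by positivity : 0 ≤ t / (2 * L)), real_inner_comm g]
    field_simp
    ring
  have split : ⟪g, z - xstar⟫ = ⟪g, z - x⟫ - ⟪g, xstar - x⟫ := by
    rw [← inner_sub_right, sub_sub_sub_cancel_right]
  have h₁ := mul_le_mul_of_nonneg_left descent (by positivity : 0 ≤ t ^ 2 / (2 * L))
  have h₂ := mul_le_mul_of_nonneg_left (hconv x xstar) (by positivity : 0 ≤ t / L)
  rw [split] at expand
  linarith
end

section
/- Let f : ℝ^d → ℝ be a differentiable L-smooth and μ-strongly convex function (0 < μ ≤ L) attaining its minimum at x*. Then for all x, z ∈ ℝ^d: √(μ/L)(f(x) − f(x*)) + √(μ/L)⟨∇f(x), z − x⟩ + f(x − (1/L)∇f(x)) − f(x) + (μ/2)√(μ/L)‖z − x*‖² + μ√(μ/L)⟨z − x*, x − z⟩ + (μ/2)(‖z − (1/√(μL))∇f(x) − x*‖² − ‖z − x*‖²) ≤ 0. -/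
open scoped RealInnerProductSpace

/-- Pointwise nonpositivity (after dividing by `A_t`) of the drift of the
Lyapunov function `φ_t = A_t(f(x_t) - f(x*)) + (μ/2)A_t‖z_t - x*‖²`,
`A_t = A₀ exp(√(μ/L) t)`, for the strongly convex continuized Nesterov parameters
`η_t = η'_t = √(μ/L)`, `γ_t = 1/L`, `γ'_t = 1/√(μL)`. -/
theorem continuized_drift_nonpos_strongly_convex {d : ℕ}
    (f : EuclideanSpace ℝ (Fin d) → ℝ)
    (L μ : ℝ) (hμ : 0 < μ) (hμL : μ ≤ L)
    (hdiff : Differentiable ℝ f)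
    (hsmooth : ∀ x y, f y ≤ f x + ⟪gradient f x, y - x⟫ + L / 2 * ‖y - x‖ ^ 2)
    (hstrconv : ∀ x y, f x + ⟪gradient f x, y - x⟫ + μ / 2 * ‖y - x‖ ^ 2 ≤ f y)
    (xstar : EuclideanSpace ℝ (Fin d)) (hmin : ∀ y, f xstar ≤ f y)
    (x z : EuclideanSpace ℝ (Fin d)) :
    Real.sqrt (μ / L) * (f x - f xstar)
      + Real.sqrt (μ / L) * ⟪gradient f x, z - x⟫
      + (f (x - (1 / L) • gradient f x) - f x)
      + μ / 2 * Real.sqrt (μ / L) * ‖z - xstar‖ ^ 2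
      + μ * Real.sqrt (μ / L) * ⟪z - xstar, x - z⟫
      + μ / 2 * (‖z - (1 / Real.sqrt (μ * L)) • gradient f x - xstar‖ ^ 2
          - ‖z - xstar‖ ^ 2) ≤ 0 := by
  have hL : 0 < L := hμ.trans_le hμL
  set g := gradient f x
  set q := Real.sqrt (μ / L)
  have hq : 0 ≤ q := Real.sqrt_nonneg _
  have hqμ : 1 / Real.sqrt (μ * L) = q / μ := by
    have hq_eq : q = Real.sqrt (μ * L) / L := by
      rw [eq_div_iff hL.ne', show μ * L = μ / L * L ^ 2 by field_simp,
        Real.sqrt_mul (by positivity), Real.sqrt_sq hL.le]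
    have hs : Real.sqrt (μ * L) ^ 2 = μ * L := Real.sq_sqrt (by positivity)
    have hs0 : 0 < Real.sqrt (μ * L) := Real.sqrt_pos.mpr (by positivity)
    rw [hq_eq]
    field_simp
    linarith
  have hq2 : q ^ 2 = μ / L := Real.sq_sqrt (by positivity)
  have hstep : f (x - (1 / L) • g) - f x ≤ -(1 / (2 * L)) * ‖g‖ ^ 2 := by
    have h := hsmooth x (x - (1 / L) • g)
    rw [sub_sub_cancel_left, norm_neg, inner_neg_right, real_inner_smul_right,
      real_inner_self_eq_norm_sq, norm_smul, mul_pow, Real.norm_eq_abs, sq_abs] at h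
    have e : L / 2 * ((1 / L) ^ 2 * ‖g‖ ^ 2) = 1 / (2 * L) * ‖g‖ ^ 2 := by
      field_simp
    have e' : 1 / L * ‖g‖ ^ 2 = 2 * (1 / (2 * L) * ‖g‖ ^ 2) := by
      field_simp
    linarith
  obtain ⟨u, hu⟩ : ∃ u, u = x - xstar := ⟨_, rfl⟩
  obtain ⟨w, hw⟩ : ∃ w, w = z - xstar := ⟨_, rfl⟩
  have hgap : f x - f xstar ≤ ⟪g, u⟫ - μ / 2 * ‖u‖ ^ 2 := by
    have h := hstrconv x xstar
    rw [show xstar - x = -u by rw [hu]; abel, inner_neg_right, norm_neg] at h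
    linarith
  have hdist : μ / 2 * (‖w - (q / μ) • g‖ ^ 2 - ‖w‖ ^ 2)
      = -(q * ⟪g, w⟫) + 1 / (2 * L) * ‖g‖ ^ 2 := by
    rw [norm_sub_sq_real, real_inner_smul_right, norm_smul, mul_pow, Real.norm_eq_abs,
      sq_abs, div_pow, hq2, real_inner_comm]
    field_simp
    ring
  have hsq : 0 ≤ q * μ / 2 * ‖w - u‖ ^ 2 := by positivity
  rw [norm_sub_sq_real] at hsq
  rw [hqμ, sub_right_comm z, ← hw, hdist, show z - x = w - u by rw [hu, hw]; abel,
    show x - z = u - w by rw [hu, hw]; abel, inner_sub_right, inner_sub_right,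
    real_inner_self_eq_norm_sq]
  linarith [mul_le_mul_of_nonneg_left hgap hq]
end

section
/- Let f : ℝ^d → ℝ be a differentiable L-smooth and μ-strongly convex function (L > 0, μ ≥ 0; μ = 0 meaning merely convex) attaining its minimum at x*. Let A, B : ℝ_{>0} → ℝ_{>0} be differentiable with A'(t) = √(2A(t)B(t)/L) and B'(t) = μ√(A(t)B(t)/(2L)) for all t, and set η_t = √(2B(t)/(L A(t))), η'_t = μ√(A(t)/(2L B(t))), γ'_t = √(A(t)/(2L B(t))). Then for all t > 0 and all x, z ∈ ℝ^d: A'(t)(f(x) − f(x*)) + A(t)η_t⟨∇f(x), z − x⟩ + A(t)(f(x − (1/L)∇f(x)) − f(x)) + B'(t)‖z − x*‖² + 2B(t)η'_t⟨z − x*, x − z⟩ + B(t)(‖z − γ'_t∇f(x) − x*‖² − ‖z − x*‖²) ≤ 0. -/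
open scoped RealInnerProductSpace

/-- A gradient step of length `1 / L` decreases an `L`-smooth function by at least
`‖∇f(x)‖² / (2L)`. -/
theorem descent_of_gradient_step {d : ℕ} {f : EuclideanSpace ℝ (Fin d) → ℝ} {L : ℝ} (hL : 0 < L)
    (hsmooth : ∀ x y, f y ≤ f x + ⟪gradient f x, y - x⟫ + L / 2 * ‖y - x‖ ^ 2)
    (x : EuclideanSpace ℝ (Fin d)) :
    f (x - (1 / L) • gradient f x) - f x ≤ -(1 / (2 * L) * ‖gradient f x‖ ^ 2) := by
  have h := hsmooth x (x - (1 / L) • gradient f x)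
  rw [sub_sub_cancel_left, inner_neg_right, real_inner_smul_right, real_inner_self_eq_norm_sq,
    norm_neg, norm_smul, mul_pow, Real.norm_eq_abs, sq_abs] at h
  have h_coeff : L / 2 * ((1 / L) ^ 2 * ‖gradient f x‖ ^ 2)
      = 1 / L * ‖gradient f x‖ ^ 2 - 1 / (2 * L) * ‖gradient f x‖ ^ 2 := by
    field_simp
    ring
  linarith

/-- Master drift inequality for the continuized Nesterov acceleration:
if `A, B : ℝ_{>0} → ℝ_{>0}` are differentiable with `A'(t) = √(2A(t)B(t)/L)` and
`B'(t) = μ√(A(t)B(t)/(2L))`, and the parameters are `η_t = √(2B(t)/(L A(t)))`,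
`η'_t = μ√(A(t)/(2L B(t)))`, `γ'_t = √(A(t)/(2L B(t)))`, then the infinitesimal drift of
`φ_t = A_t(f(x_t) - f(x*)) + B_t‖z_t - x*‖²` is pointwise nonpositive.
(Here `μ ≥ 0`, `μ = 0` meaning plain convexity.) -/
theorem continuized_master_drift_nonpos {d : ℕ} (f : EuclideanSpace ℝ (Fin d) → ℝ)
    (L μ : ℝ) (hL : 0 < L) (hμ : 0 ≤ μ)
    (hdiff : Differentiable ℝ f)
    (hsmooth : ∀ x y, f y ≤ f x + ⟪gradient f x, y - x⟫ + L / 2 * ‖y - x‖ ^ 2)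
    (hstrconv : ∀ x y, f x + ⟪gradient f x, y - x⟫ + μ / 2 * ‖y - x‖ ^ 2 ≤ f y)
    (xstar : EuclideanSpace ℝ (Fin d)) (hmin : ∀ y, f xstar ≤ f y)
    (A B : ℝ → ℝ)
    (hApos : ∀ t, 0 < t → 0 < A t) (hBpos : ∀ t, 0 < t → 0 < B t)
    (hA' : ∀ t, 0 < t →
      HasDerivWithinAt A (Real.sqrt (2 * A t * B t / L)) (Set.Ioi 0) t)
    (hB' : ∀ t, 0 < t →
      HasDerivWithinAt B (μ * Real.sqrt (A t * B t / (2 * L))) (Set.Ioi 0) t)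
    (t : ℝ) (ht : 0 < t) (x z : EuclideanSpace ℝ (Fin d)) :
    Real.sqrt (2 * A t * B t / L) * (f x - f xstar)
      + A t * Real.sqrt (2 * B t / (L * A t)) * ⟪gradient f x, z - x⟫
      + A t * (f (x - (1 / L) • gradient f x) - f x)
      + μ * Real.sqrt (A t * B t / (2 * L)) * ‖z - xstar‖ ^ 2
      + 2 * B t * (μ * Real.sqrt (A t / (2 * L * B t))) * ⟪z - xstar, x - z⟫
      + B t * (‖z - Real.sqrt (A t / (2 * L * B t)) • gradient f x - xstar‖ ^ 2
          - ‖z - xstar‖ ^ 2) ≤ 0 := by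
  have hA := hApos t ht
  have hB := hBpos t ht
  set a := A t
  set b := B t
  set g := gradient f x
  have h_sqrt_A : √(2 * a * b / L) = 2 * b * √(a / (2 * L * b)) := by
    rw [show 2 * a * b / L = (2 * b) ^ 2 * (a / (2 * L * b)) by field_simp,
      Real.sqrt_mul (sq_nonneg _), Real.sqrt_sq (by positivity)]
  have h_sqrt_η : a * √(2 * b / (L * a)) = 2 * b * √(a / (2 * L * b)) := by
    rw [← h_sqrt_A, show 2 * a * b / L = a ^ 2 * (2 * b / (L * a)) by field_simp,
      Real.sqrt_mul (sq_nonneg _), Real.sqrt_sq hA.le]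
  have h_sqrt_B : √(a * b / (2 * L)) = b * √(a / (2 * L * b)) := by
    rw [show a * b / (2 * L) = b ^ 2 * (a / (2 * L * b)) by field_simp,
      Real.sqrt_mul (sq_nonneg _), Real.sqrt_sq hB.le]
  have h_sq : b * √(a / (2 * L * b)) ^ 2 = a / (2 * L) := by
    rw [Real.sq_sqrt (by positivity)]
    field_simp
  rw [h_sqrt_A, h_sqrt_η, h_sqrt_B]
  set c := √(a / (2 * L * b))
  have hc : 0 ≤ c := Real.sqrt_nonneg _
  have h_descent := mul_le_mul_of_nonneg_left (descent_of_gradient_step hL hsmooth x) hA.le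
  have h_expand : ‖z - c • g - xstar‖ ^ 2
      = ‖z - xstar‖ ^ 2 - 2 * c * ⟪g, z - xstar⟫ + c ^ 2 * ‖g‖ ^ 2 := by
    rw [sub_right_comm, norm_sub_sq_real, real_inner_smul_right, norm_smul, mul_pow,
      Real.norm_eq_abs, sq_abs, real_inner_comm]
    ring
  have h_inner : ⟪g, z - x⟫ = ⟪g, z - xstar⟫ + ⟪g, xstar - x⟫ := by
    rw [← inner_add_right, sub_add_sub_cancel]
  have h_polar : ‖xstar - x‖ ^ 2
      = ‖x - z‖ ^ 2 + 2 * ⟪z - xstar, x - z⟫ + ‖z - xstar‖ ^ 2 := by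
    rw [norm_sub_rev, ← sub_add_sub_cancel x z xstar, norm_add_sq_real, real_inner_comm]
  have h_strong := hstrconv x xstar
  rw [h_polar] at h_strong
  have h_bracket : f x - f xstar + ⟪g, xstar - x⟫ + μ / 2 * ‖z - xstar‖ ^ 2
      + μ * ⟪z - xstar, x - z⟫ ≤ 0 := by
    have := mul_nonneg hμ (sq_nonneg ‖x - z‖)
    linarith
  have h_scaled := mul_nonpos_of_nonneg_of_nonpos (by positivity : 0 ≤ 2 * b * c) h_bracket
  have h_sq_norm : b * c ^ 2 * ‖g‖ ^ 2 = a * (1 / (2 * L) * ‖g‖ ^ 2) := by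
    rw [h_sq]
    ring
  rw [h_expand, h_inner]
  linarith
end

section
/- Let a > 0, t_0 ≤ t_1, and let x, z : [t_0, t_1] → ℝ^d be differentiable with x'(t) = a(z(t) − x(t)) and z'(t) = a(x(t) − z(t)) for all t ∈ [t_0, t_1]. Then z(t_1) = z(t_0) + tanh(a(t_1 − t_0)) (x(t_1) − z(t_0)). -/
theorem tanh_eq_exp_two_mul (s : ℝ) :
    Real.tanh s = (Real.exp (2 * s) - 1) / (Real.exp (2 * s) + 1) := by
  have h : Real.exp (2 * s) = Real.exp s * Real.exp s := by
    rw [← Real.exp_add, two_mul]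
  have := Real.exp_pos s
  rw [Real.tanh_eq_sinh_div_cosh, Real.sinh_eq, Real.cosh_eq, Real.exp_neg, h]
  field_simp

/-- A first integral of the symmetric mixing ODE. -/
theorem mixing_ode_first_integral {E : Type*} [NormedAddCommGroup E] [NormedSpace ℝ E]
    {a t₀ t₁ : ℝ} {x z : ℝ → E}
    (hx : ∀ t ∈ Set.Icc t₀ t₁,
      HasDerivWithinAt x (a • (z t - x t)) (Set.Icc t₀ t₁) t)
    (hz : ∀ t ∈ Set.Icc t₀ t₁,
      HasDerivWithinAt z (a • (x t - z t)) (Set.Icc t₀ t₁) t)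
    {t : ℝ} (ht : t ∈ Set.Icc t₀ t₁) :
    x t + z t + Real.exp (2 * (a * (t - t₀))) • (z t - x t) = (2 : ℝ) • z t₀ := by
  let F : ℝ → E := fun t => x t + z t + Real.exp (2 * (a * (t - t₀))) • (z t - x t)
  have hF : ∀ s ∈ Set.Icc t₀ t₁, HasDerivWithinAt F 0 (Set.Icc t₀ t₁) s := by
    intro s hs
    have he : HasDerivAt (fun t => Real.exp (2 * (a * (t - t₀))))
        (Real.exp (2 * (a * (s - t₀))) * (2 * (a * 1))) s :=
      ((((hasDerivAt_id s).sub_const t₀).const_mul a).const_mul 2).exp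
    refine (((hx s hs).add (hz s hs)).add
      (he.hasDerivWithinAt.smul ((hz s hs).sub (hx s hs)))).congr_deriv ?_
    simp only [Pi.sub_apply]
    module
  have hconst : F t = F t₀ :=
    constant_of_has_deriv_right_zero (fun s hs => (hF s hs).continuousWithinAt)
      (fun s hs => (hF s (Set.Ico_subset_Icc_self hs)).mono_of_mem_nhdsWithin
        (Icc_mem_nhdsGE_of_mem hs)) t ht
  refine hconst.trans ?_
  simp only [F, sub_self, mul_zero, Real.exp_zero]
  module

/-- For the symmetric mixing ODE `x'(t) = a(z(t) - x(t))`,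
`z'(t) = a(x(t) - z(t))` on `[t₀, t₁]`, the terminal value of `z` is a `tanh`-combination
of its initial value and the terminal value of `x`:
`z(t₁) = z(t₀) + tanh(a(t₁ - t₀))(x(t₁) - z(t₀))`. -/
theorem mixing_ode_tanh_combination {d : ℕ} (a : ℝ) (ha : 0 < a)
    (t₀ t₁ : ℝ) (ht : t₀ ≤ t₁)
    (x z : ℝ → EuclideanSpace ℝ (Fin d))
    (hx : ∀ t ∈ Set.Icc t₀ t₁,
      HasDerivWithinAt x (a • (z t - x t)) (Set.Icc t₀ t₁) t)
    (hz : ∀ t ∈ Set.Icc t₀ t₁,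
      HasDerivWithinAt z (a • (x t - z t)) (Set.Icc t₀ t₁) t) :
    z t₁ = z t₀ + Real.tanh (a * (t₁ - t₀)) • (x t₁ - z t₀) := by
  have hF := mixing_ode_first_integral hx hz (Set.right_mem_Icc.mpr ht)
  rw [tanh_eq_exp_two_mul]
  have hpos := Real.exp_pos (2 * (a * (t₁ - t₀)))
  generalize Real.exp (2 * (a * (t₁ - t₀))) = e at hF hpos ⊢
  have hz₀ : z t₀ = (1 / 2 : ℝ) • (x t₁ + z t₁ + e • (z t₁ - x t₁)) := by
    rw [hF]
    module
  rw [hz₀]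
  match_scalars <;> field_simp <;> ring
end

section
/- Let f : ℝ^d → ℝ be a differentiable L-smooth function (L > 0), let x* ∈ ℝ^d, let (Ξ, P) be a measurable space with a probability measure, let σ ≥ 0, and let x, z ∈ ℝ^d. Let G : Ξ → ℝ^d be measurable with ∫ G(ξ) dP(ξ) = ∇f(x) and ∫ ‖G(ξ) − ∇f(x)‖² dP(ξ) ≤ σ². Then for all A, B, γ, γ' ≥ 0: ∫ [A(f(x − γG(ξ)) − f(x)) + B(‖z − γ'G(ξ) − x*‖² − ‖z − x*‖²)] dP(ξ) ≤ −Aγ(1 − Lγ/2)‖∇f(x)‖² − 2Bγ'⟨∇f(x), z − x*⟩ + Bγ'²‖∇f(x)‖² + σ²(ALγ²/2 + Bγ'²). -/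
open MeasureTheory
open scoped RealInnerProductSpace

section RandomVectorMoments

variable {E Ξ : Type*} [NormedAddCommGroup E] [InnerProductSpace ℝ E]
  [MeasurableSpace Ξ] {P : Measure Ξ} [IsProbabilityMeasure P] {G : Ξ → E} {m : E}

theorem integrable_const_add_inner_add_norm_sub_sq (hG : Integrable G P)
    (hvar : Integrable (fun ξ => ‖G ξ - m‖ ^ 2) P) (c a : ℝ) (u : E) :
    Integrable (fun ξ => c + ⟪u, G ξ - m⟫ + a * ‖G ξ - m‖ ^ 2) P :=
  ((integrable_const c).add ((hG.sub (integrable_const m)).const_inner u)).add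
    (hvar.const_mul a)

theorem integral_const_add_inner_add_norm_sub_sq [CompleteSpace E] (hG : Integrable G P)
    (hmean : ∫ ξ, G ξ ∂P = m) (hvar : Integrable (fun ξ => ‖G ξ - m‖ ^ 2) P)
    (c a : ℝ) (u : E) :
    ∫ ξ, (c + ⟪u, G ξ - m⟫ + a * ‖G ξ - m‖ ^ 2) ∂P
      = c + a * ∫ ξ, ‖G ξ - m‖ ^ 2 ∂P := by
  have hw : Integrable (fun ξ => G ξ - m) P := hG.sub (integrable_const m)
  have hinner : ∫ ξ, ⟪u, G ξ - m⟫ ∂P = 0 := by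
    rw [integral_inner hw, integral_sub hG (integrable_const m), hmean]
    simp
  have hlin : Integrable (fun ξ => c + ⟪u, G ξ - m⟫) P :=
    (integrable_const c).add (hw.const_inner u)
  rw [integral_add hlin (hvar.const_mul a),
    integral_add (integrable_const c) (hw.const_inner u), hinner, integral_const_mul]
  simp

end RandomVectorMoments

theorem norm_sub_smul_sq_eq_deviation {E : Type*} [NormedAddCommGroup E]
    [InnerProductSpace ℝ E] (y v m : E) (t : ℝ) :
    ‖y - t • v‖ ^ 2 = ‖y‖ ^ 2 - 2 * t * ⟪m, y⟫ + t ^ 2 * ‖m‖ ^ 2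
      + ⟪(2 * t ^ 2) • m - (2 * t) • y, v - m⟫ + t ^ 2 * ‖v - m‖ ^ 2 := by
  simp only [← real_inner_self_eq_norm_sq, inner_sub_left, inner_sub_right,
    real_inner_smul_left, real_inner_smul_right]
  rw [real_inner_comm v y, real_inner_comm m y, real_inner_comm v m]
  ring

/-- Expected change of the Lyapunov terms under a stochastic gradient
jump: if `G` is an unbiased stochastic gradient of the `L`-smooth function `f` at `x` with
variance bounded by `σ²`, then for all `A, B, γ, γ' ≥ 0`,
`∫ [A(f(x - γG(ξ)) - f(x)) + B(‖z - γ'G(ξ) - x*‖² - ‖z - x*‖²)] dP(ξ)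
  ≤ -Aγ(1 - Lγ/2)‖∇f(x)‖² - 2Bγ'⟨∇f(x), z - x*⟩ + Bγ'²‖∇f(x)‖² + σ²(ALγ²/2 + Bγ'²)`. -/
theorem stochastic_gradient_jump_bound {d : ℕ} (f : EuclideanSpace ℝ (Fin d) → ℝ)
    (L : ℝ) (hL : 0 < L)
    (hdiff : Differentiable ℝ f)
    (hsmooth : ∀ x y, f y ≤ f x + ⟪gradient f x, y - x⟫ + L / 2 * ‖y - x‖ ^ 2)
    (xstar : EuclideanSpace ℝ (Fin d))
    {Ξ : Type*} [MeasurableSpace Ξ] (P : Measure Ξ) [IsProbabilityMeasure P]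
    (σ : ℝ) (hσ : 0 ≤ σ)
    (x z : EuclideanSpace ℝ (Fin d))
    (G : Ξ → EuclideanSpace ℝ (Fin d)) (hGmeas : Measurable G)
    (hGint : Integrable G P)
    (hGmean : ∫ ξ, G ξ ∂P = gradient f x)
    (hGvarInt : Integrable (fun ξ => ‖G ξ - gradient f x‖ ^ 2) P)
    (hGvar : ∫ ξ, ‖G ξ - gradient f x‖ ^ 2 ∂P ≤ σ ^ 2)
    (A B γ γ' : ℝ) (hA : 0 ≤ A) (hB : 0 ≤ B) (hγ : 0 ≤ γ) (hγ' : 0 ≤ γ')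
    (hfint : Integrable (fun ξ => f (x - γ • G ξ)) P) :
    ∫ ξ, (A * (f (x - γ • G ξ) - f x)
        + B * (‖z - γ' • G ξ - xstar‖ ^ 2 - ‖z - xstar‖ ^ 2)) ∂P ≤
      -(A * γ * (1 - L * γ / 2)) * ‖gradient f x‖ ^ 2
        - 2 * B * γ' * ⟪gradient f x, z - xstar⟫
        + B * γ' ^ 2 * ‖gradient f x‖ ^ 2
        + σ ^ 2 * (A * L * γ ^ 2 / 2 + B * γ' ^ 2) := by
  set g := gradient f x with hg
  have hdist (ξ : Ξ) := norm_sub_smul_sq_eq_deviation (z - xstar) (G ξ) g γ'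
  have hdescent (ξ : Ξ) : f (x - γ • G ξ) - f x ≤
      -(γ * (1 - L * γ / 2)) * ‖g‖ ^ 2 + ⟪(L * γ ^ 2 - γ) • g, G ξ - g⟫
        + L * γ ^ 2 / 2 * ‖G ξ - g‖ ^ 2 := by
    have h := hsmooth x (x - γ • G ξ)
    rw [← hg, sub_sub_cancel_left, norm_neg, norm_smul, mul_pow, Real.norm_eq_abs, sq_abs,
      inner_neg_right, real_inner_smul_right] at h
    have hn := norm_sub_sq_real (G ξ) g
    rw [real_inner_smul_left, inner_sub_right, real_inner_self_eq_norm_sq, hn,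
      real_inner_comm g (G ξ)]
    linarith
  have hquad (ξ : Ξ) : ‖z - γ' • G ξ - xstar‖ ^ 2 = ‖(z - xstar) - γ' • G ξ‖ ^ 2 := by
    rw [sub_right_comm]
  have hdistInt : Integrable (fun ξ => ‖z - γ' • G ξ - xstar‖ ^ 2) P := by
    simp_rw [hquad, hdist]
    exact integrable_const_add_inner_add_norm_sub_sq hGint hGvarInt _ _ _
  let c : ℝ := -(A * γ * (1 - L * γ / 2)) * ‖g‖ ^ 2 - 2 * B * γ' * ⟪g, z - xstar⟫
    + B * γ' ^ 2 * ‖g‖ ^ 2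
  let a : ℝ := A * L * γ ^ 2 / 2 + B * γ' ^ 2
  let u : EuclideanSpace ℝ (Fin d) :=
    A • (L * γ ^ 2 - γ) • g + B • ((2 * γ' ^ 2) • g - (2 * γ') • (z - xstar))
  have ha : 0 ≤ a := by positivity
  calc
    _ ≤ ∫ ξ, (c + ⟪u, G ξ - g⟫ + a * ‖G ξ - g‖ ^ 2) ∂P := by
      refine integral_mono
        (((hfint.sub (integrable_const _)).const_mul A).add
          ((hdistInt.sub (integrable_const _)).const_mul B))
        (integrable_const_add_inner_add_norm_sub_sq hGint hGvarInt c a u) fun ξ => ?_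
      have h := mul_le_mul_of_nonneg_left (hdescent ξ) hA
      have hu : ⟪u, G ξ - g⟫ = A * ⟪(L * γ ^ 2 - γ) • g, G ξ - g⟫
          + B * ⟪(2 * γ' ^ 2) • g - (2 * γ') • (z - xstar), G ξ - g⟫ := by
        rw [inner_add_left, real_inner_smul_left (r := A), real_inner_smul_left (r := B)]
      simp only [hquad, hdist, hu, c, a]
      linarith
    _ = c + a * ∫ ξ, ‖G ξ - g‖ ^ 2 ∂P :=
      integral_const_add_inner_add_norm_sub_sq hGint hGmean hGvarInt c a u
    _ ≤ c + σ ^ 2 * a := by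
      rw [mul_comm (σ ^ 2)]
      gcongr
end
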